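/- arXiv:2507.17122 — 2 statements merged into one kernel-verified Lean document; each statement's English description precedes it below -/
import Mathlib

section
/- Let α < β be real numbers and let X = C([α,β]) be the space of continuous real-valued functions on [α,β] with the supremum norm ‖φ‖ = max_{r∈[α,β]} |φ(r)|. Then for all τ, υ > 0, L^I_YJ(τ, υ, X) = 2(τ+υ)²/υ². -/
noncomputable section

/-- Isosceles orthogonality: `x ⊥_I y` iff `‖x + y‖ = ‖x - y‖`. -/
def IsoOrth {X : Type*} [NormedAddCommGroup X] (x y : X) : Prop := ‖x + y‖ = ‖x - y‖

variable (X : Type*) [NormedAddCommGroup X] [NormedSpace ℝ X]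

/-- The constant `H̃(X)`. -/
def Htilde : ℝ :=
  sSup {r : ℝ | ∃ x y : X, (x, y) ≠ (0, 0) ∧ IsoOrth x y ∧ r = (‖x‖ + ‖y‖) / ‖x + y‖}

/-- The constant `A₂(X)`. -/
def A2 : ℝ :=
  sSup {r : ℝ | ∃ x y : X, ‖x‖ = 1 ∧ ‖y‖ = 1 ∧ r = (‖x + y‖ + ‖x - y‖) / 2}

/-- Clarkson's modulus of convexity `δ_X(ε)`. -/
def modulusConvexity (ε : ℝ) : ℝ :=
  sInf {r : ℝ | ∃ x y : X, ‖x‖ ≤ 1 ∧ ‖y‖ ≤ 1 ∧ ε ≤ ‖x - y‖ ∧ r = 1 - ‖x + y‖ / 2}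

/-- The constant `H̃²(X)`. -/
def HtildeSq : ℝ :=
  sSup {r : ℝ | ∃ x y : X, (x, y) ≠ (0, 0) ∧ IsoOrth x y ∧
    r = (‖x‖ ^ 2 + ‖y‖ ^ 2) / ‖x + y‖ ^ 2}

/-- The modified von Neumann–Jordan constant `C′_NJ(X)`. -/
def CNJmod : ℝ :=
  sSup {r : ℝ | ∃ x y : X, ‖x‖ = 1 ∧ ‖y‖ = 1 ∧ r = (‖x + y‖ ^ 2 + ‖x - y‖ ^ 2) / 4}

/-- The von Neumann–Jordan constant `C_NJ(X)`. -/
def CNJ : ℝ :=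
  sSup {r : ℝ | ∃ x y : X, (x, y) ≠ (0, 0) ∧
    r = (‖x + y‖ ^ 2 + ‖x - y‖ ^ 2) / (2 * ‖x‖ ^ 2 + 2 * ‖y‖ ^ 2)}

/-- The James constant in its isosceles-orthogonality form. -/
def JamesConst : ℝ :=
  sSup {r : ℝ | ∃ x y : X, ‖x‖ ≤ 1 ∧ ‖y‖ ≤ 1 ∧ IsoOrth x y ∧ r = ‖x + y‖}

/-- The constant `E_I(t, X)`. -/
def EI (t : ℝ) : ℝ :=
  sSup {r : ℝ | ∃ x y : X, (x, y) ≠ (0, 0) ∧ IsoOrth x y ∧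
    r = (‖(t + 1) • x + (1 - t) • y‖ ^ 2 + ‖(1 - t) • x - (t + 1) • y‖ ^ 2) / ‖x + y‖ ^ 2}

/-- The skew constant `E(t, X)`. -/
def Eskew (t : ℝ) : ℝ :=
  sSup {r : ℝ | ∃ x y : X, ‖x‖ = 1 ∧ ‖y‖ = 1 ∧ r = ‖x + t • y‖ ^ 2 + ‖t • x - y‖ ^ 2}

/-- The constant `L^I_YJ(τ, υ, X)`. -/
def LIYJ (τ υ : ℝ) : ℝ :=
  sSup {r : ℝ | ∃ x y : X, (x, y) ≠ (0, 0) ∧ IsoOrth x y ∧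
    r = (‖(τ + υ) • x + (υ - τ) • y‖ ^ 2 + ‖(υ - τ) • x - (τ + υ) • y‖ ^ 2) /
      (υ ^ 2 * ‖x + y‖ ^ 2)}

/-- The modified skew von Neumann–Jordan constant `L′_YJ(τ, υ, X)`. -/
def LYJmod (τ υ : ℝ) : ℝ :=
  sSup {r : ℝ | ∃ x y : X, ‖x‖ = 1 ∧ ‖y‖ = 1 ∧
    r = (‖τ • x + υ • y‖ ^ 2 + ‖υ • x - τ • y‖ ^ 2) / (2 * (τ ^ 2 + υ ^ 2))}

end

/-- In any real normed space, every quotient defining `L^I_YJ(τ, υ, X)` is at most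
`2(τ+υ)²/υ²`. -/
theorem IsoOrth.quotient_le {X : Type*} [NormedAddCommGroup X] [NormedSpace ℝ X] {x y : X}
    (h : IsoOrth x y) {τ υ : ℝ} (hτ : 0 < τ) (hυ : 0 < υ) :
    (‖(τ + υ) • x + (υ - τ) • y‖ ^ 2 + ‖(υ - τ) • x - (τ + υ) • y‖ ^ 2) /
      (υ ^ 2 * ‖x + y‖ ^ 2) ≤ 2 * (τ + υ) ^ 2 / υ ^ 2 := by
  have h_sum : ‖(τ + υ) • x + (υ - τ) • y‖ ≤ (τ + υ) * ‖x + y‖ := by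
    calc ‖(τ + υ) • x + (υ - τ) • y‖ = ‖υ • (x + y) + τ • (x - y)‖ := by congr 1; module
      _ ≤ ‖υ • (x + y)‖ + ‖τ • (x - y)‖ := norm_add_le _ _
      _ = (τ + υ) * ‖x + y‖ := by
        rw [norm_smul_of_nonneg hυ.le, norm_smul_of_nonneg hτ.le, ← h]; ring
  have h_diff : ‖(υ - τ) • x - (τ + υ) • y‖ ≤ (τ + υ) * ‖x + y‖ := by
    calc ‖(υ - τ) • x - (τ + υ) • y‖ = ‖υ • (x - y) - τ • (x + y)‖ := by congr 1; module
      _ ≤ ‖υ • (x - y)‖ + ‖τ • (x + y)‖ := norm_sub_le _ _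
      _ = (τ + υ) * ‖x + y‖ := by
        rw [norm_smul_of_nonneg hυ.le, norm_smul_of_nonneg hτ.le, ← h]; ring
  have h_num : ‖(τ + υ) • x + (υ - τ) • y‖ ^ 2 + ‖(υ - τ) • x - (τ + υ) • y‖ ^ 2 ≤
      2 * (τ + υ) ^ 2 * ‖x + y‖ ^ 2 := by
    have := pow_le_pow_left₀ (norm_nonneg _) h_sum 2
    have := pow_le_pow_left₀ (norm_nonneg _) h_diff 2
    linarith
  refine div_le_of_le_mul₀ (by positivity) (by positivity) (h_num.trans_eq ?_)
  field_simp

/-- For `X = C([α,β])` with the supremum norm (`α < β`),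
`L^I_YJ(τ, υ, X) = 2(τ+υ)²/υ²` for all `τ, υ > 0`. -/
theorem stmt10 (α β : ℝ) (hab : α < β) (τ υ : ℝ) (hτ : 0 < τ) (hυ : 0 < υ) :
    LIYJ C(Set.Icc α β, ℝ) τ υ = 2 * (τ + υ) ^ 2 / υ ^ 2 := by
  refine IsGreatest.csSup_eq ⟨?_, ?_⟩
  · have hβα : 0 < β - α := sub_pos.2 hab
    let t : C(Set.Icc α β, ℝ) := ⟨fun r => (r - α) / (β - α), by fun_prop⟩
    let a : Set.Icc α β := ⟨α, Set.left_mem_Icc.2 hab.le⟩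
    let b : Set.Icc α β := ⟨β, Set.right_mem_Icc.2 hab.le⟩
    have : Nonempty (Set.Icc α β) := ⟨a⟩
    have hta : t a = 0 := by simp [t, a]
    have htb : t b = 1 := by simp [t, b, hβα.ne']
    have ht0 : ∀ r, 0 ≤ t r := fun r => div_nonneg (sub_nonneg.2 r.2.1) hβα.le
    have ht1 : ∀ r, t r ≤ 1 := fun r => (div_le_one hβα).2 (sub_le_sub_right r.2.2 α)
    have h_add : ‖(1 - t) + t‖ = 1 := by simp
    have h_sub : ‖(1 - t) - t‖ = 1 := by
      refine le_antisymm ((ContinuousMap.norm_le _ zero_le_one).2 fun r => ?_) ?_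
      · simp only [ContinuousMap.sub_apply, ContinuousMap.one_apply, Real.norm_eq_abs, abs_le]
        constructor <;> linarith [ht0 r, ht1 r]
      · simpa [hta] using ((1 - t) - t).norm_coe_le_norm a
    have h_orth : IsoOrth (1 - t) t := h_add.trans h_sub.symm
    refine ⟨1 - t, t, fun h => ?_, h_orth, le_antisymm ?_ (h_orth.quotient_le hτ hυ)⟩
    · have h0 : t = 0 := congrArg Prod.snd h
      simp [h0] at htb
    · have h_left : τ + υ ≤ ‖(τ + υ) • (1 - t) + (υ - τ) • t‖ := by
        simpa [hta, abs_of_pos (add_pos hτ hυ)] using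
          ((τ + υ) • (1 - t) + (υ - τ) • t).norm_coe_le_norm a
      have h_right : τ + υ ≤ ‖(υ - τ) • (1 - t) - (τ + υ) • t‖ := by
        have h := ((υ - τ) • (1 - t) - (τ + υ) • t).norm_coe_le_norm b
        refine le_trans (le_of_eq ?_) h
        simp only [ContinuousMap.sub_apply, ContinuousMap.smul_apply, ContinuousMap.one_apply, htb,
          sub_self, mul_zero, zero_sub, abs_neg, smul_eq_mul, mul_one, Real.norm_eq_abs]
        exact (abs_of_pos (add_pos hτ hυ)).symm
      rw [h_add, one_pow, mul_one, two_mul]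
      gcongr
  · rintro _ ⟨x, y, -, h, rfl⟩
    exact h.quotient_le hτ hυ
end

section
/- A nontrivial real normed linear space X is an inner product space (i.e., its norm is induced by an inner product) if and only if ‖τx + υy‖² + ‖υx − τy‖² ≤ 2(τ² + υ²) for all nonnegative real numbers τ, υ and all x, y in the unit sphere S_X. -/
/-- The binary quadratic form `a s² + 2 b s t + c t²`. -/
def binaryForm (a b c : ℝ) (w : ℝ × ℝ) : ℝ :=
  a * w.1 ^ 2 + 2 * b * w.1 * w.2 + c * w.2 ^ 2

theorem continuous_binaryForm (a b c : ℝ) : Continuous (binaryForm a b c) := by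
  unfold binaryForm
  fun_prop

theorem binaryForm_smul (a b c r : ℝ) (w : ℝ × ℝ) :
    binaryForm a b c (r • w) = r ^ 2 * binaryForm a b c w := by
  simp only [binaryForm, Prod.smul_fst, Prod.smul_snd, smul_eq_mul]
  ring

theorem binaryForm_nonneg {a b c : ℝ} (ha : 0 ≤ a) (hc : 0 ≤ c) (hb : b ^ 2 ≤ a * c)
    (w : ℝ × ℝ) : 0 ≤ binaryForm a b c w := by
  unfold binaryForm
  rcases ha.eq_or_lt with rfl | ha
  · have : b = 0 := by nlinarith [sq_nonneg b]
    subst this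
    nlinarith [mul_nonneg hc (sq_nonneg w.2)]
  · refine nonneg_of_mul_nonneg_right ?_ ha
    nlinarith [sq_nonneg (a * w.1 + b * w.2), mul_nonneg (sub_nonneg.2 hb) (sq_nonneg w.2)]

/-- The Euclidean unit circle in `ℝ × ℝ`. -/
def euclideanCircle : Set (ℝ × ℝ) := {w | w.1 ^ 2 + w.2 ^ 2 = 1}

theorem isCompact_euclideanCircle : IsCompact euclideanCircle := by
  refine (isCompact_Icc (a := ((-1, -1) : ℝ × ℝ)) (b := (1, 1))).of_isClosed_subset
    (isClosed_eq (by fun_prop) continuous_const) ?_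
  rintro ⟨s, t⟩ (h : s ^ 2 + t ^ 2 = 1)
  simp only [Set.mem_Icc, Prod.mk_le_mk]
  refine ⟨⟨?_, ?_⟩, ?_, ?_⟩ <;> nlinarith [sq_nonneg s, sq_nonneg t]

theorem ne_zero_of_mem_euclideanCircle {w : ℝ × ℝ} (h : w ∈ euclideanCircle) : w ≠ 0 := by
  rintro rfl
  simp [euclideanCircle] at h

theorem le_of_le_on_euclideanCircle {F G : ℝ × ℝ → ℝ}
    (hF : ∀ (r : ℝ) w, F (r • w) = r ^ 2 * F w) (hG : ∀ (r : ℝ) w, G (r • w) = r ^ 2 * G w)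
    (h : ∀ w ∈ euclideanCircle, G w ≤ F w) (w : ℝ × ℝ) : G w ≤ F w := by
  by_cases hw : w = 0
  · have h₁ := hF 0 0
    have h₂ := hG 0 0
    simp only [smul_zero] at h₁ h₂
    subst hw
    linarith
  · have hpos : 0 < w.1 ^ 2 + w.2 ^ 2 := by
      by_contra! hle
      refine hw (Prod.ext ?_ ?_)
      · exact pow_eq_zero_iff two_ne_zero |>.1 (by nlinarith [sq_nonneg w.1, sq_nonneg w.2])
      · exact pow_eq_zero_iff two_ne_zero |>.1 (by nlinarith [sq_nonneg w.1, sq_nonneg w.2])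
    set r := √(w.1 ^ 2 + w.2 ^ 2) with hr
    have hr0 : 0 < r := Real.sqrt_pos.2 hpos
    have hr2 : r ^ 2 = w.1 ^ 2 + w.2 ^ 2 := Real.sq_sqrt hpos.le
    have hmem : r⁻¹ • w ∈ euclideanCircle := by
      simp only [euclideanCircle, Set.mem_ofPred_eq, Prod.smul_fst, Prod.smul_snd, smul_eq_mul]
      field_simp
      exact hr2.symm
    have hle := h _ hmem
    have hw' : w = r • (r⁻¹ • w) := by rw [smul_inv_smul₀ hr0.ne']
    rw [hw', hF, hG]
    gcongr

theorem exists_pos_add_le_of_lt {K : Set (ℝ × ℝ)} (hK : IsCompact K) {F G : ℝ × ℝ → ℝ}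
    (hF : Continuous F) (hG : Continuous G) (h : ∀ w ∈ K, G w < F w) :
    ∃ δ > 0, ∀ w ∈ K, G w + δ ≤ F w := by
  rcases K.eq_empty_or_nonempty with rfl | hne
  · exact ⟨1, one_pos, by simp⟩
  · obtain ⟨w₀, hw₀, hmin⟩ := hK.exists_isMinOn hne (hF.sub hG).continuousOn
    refine ⟨F w₀ - G w₀, sub_pos.2 (h _ hw₀), fun w hw => ?_⟩
    have : F w₀ - G w₀ ≤ F w - G w := hmin hw
    linarith

/-- The coefficients of the positive semidefinite binary forms dominated by `F`. -/
def dominatedForms (F : ℝ × ℝ → ℝ) : Set (ℝ × ℝ × ℝ) :=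
  {p | 0 ≤ p.1 ∧ 0 ≤ p.2.2 ∧ p.2.1 ^ 2 ≤ p.1 * p.2.2 ∧
    ∀ w, binaryForm p.1 p.2.1 p.2.2 w ≤ F w}

theorem isCompact_dominatedForms (F : ℝ × ℝ → ℝ) : IsCompact (dominatedForms F) := by
  set A := F (1, 0)
  set C := F (0, 1)
  refine (isCompact_Icc (a := ((0, -(A + C), 0) : ℝ × ℝ × ℝ))
    (b := (A, A + C, C))).of_isClosed_subset ?_ ?_
  · have h₁ : IsClosed {p : ℝ × ℝ × ℝ | 0 ≤ p.1} := isClosed_le (by fun_prop) (by fun_prop)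
    have h₂ : IsClosed {p : ℝ × ℝ × ℝ | 0 ≤ p.2.2} := isClosed_le (by fun_prop) (by fun_prop)
    have h₃ : IsClosed {p : ℝ × ℝ × ℝ | p.2.1 ^ 2 ≤ p.1 * p.2.2} :=
      isClosed_le (by fun_prop) (by fun_prop)
    have h₄ : IsClosed {p : ℝ × ℝ × ℝ | ∀ w, binaryForm p.1 p.2.1 p.2.2 w ≤ F w} := by
      simp only [binaryForm, Set.ofPred_forall]
      exact isClosed_iInter fun w => isClosed_le (by fun_prop) continuous_const
    exact h₁.inter (h₂.inter (h₃.inter h₄))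
  · rintro ⟨a, b, c⟩ ⟨ha, hc, hb, h⟩
    have hA := h (1, 0)
    have hC := h (0, 1)
    simp only [binaryForm] at ha hc hb hA hC
    have hA' : a ≤ A := by simpa using hA
    have hC' : c ≤ C := by simpa using hC
    have hb' : |b| ≤ A + C :=
      abs_le_of_sq_le_sq (by nlinarith) (by linarith)
    simp only [Set.mem_Icc, Prod.mk_le_mk]
    exact ⟨⟨ha, (abs_le.1 hb').1, hc⟩, hA', (abs_le.1 hb').2, hC'⟩

/-- A positive 2-homogeneous continuous function on the plane dominates a binary quadratic form
that agrees with it at two linearly independent points: any dominated form of maximal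
discriminant has this property. -/
theorem exists_binaryForm_le_and_contact {F : ℝ × ℝ → ℝ} (hcont : Continuous F)
    (hhom : ∀ (r : ℝ) w, F (r • w) = r ^ 2 * F w) (hpos : ∀ w, w ≠ 0 → 0 < F w) :
    ∃ a b c : ℝ, (∀ w, binaryForm a b c w ≤ F w) ∧
      ∃ u v : ℝ × ℝ, u.1 * v.2 - u.2 * v.1 ≠ 0 ∧
        binaryForm a b c u = F u ∧ binaryForm a b c v = F v := by
  obtain ⟨μ, hμ, hμF⟩ := exists_pos_add_le_of_lt isCompact_euclideanCircle hcont
    (continuous_const (y := (0 : ℝ))) fun w hw => hpos w (ne_zero_of_mem_euclideanCircle hw)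
  have hμmem : (μ, 0, μ) ∈ dominatedForms F := by
    refine ⟨hμ.le, hμ.le, by nlinarith [mul_pos hμ hμ],
      le_of_le_on_euclideanCircle hhom (binaryForm_smul _ _ _) fun w hw => ?_⟩
    have h₁ := hμF w hw
    have h₂ : w.1 ^ 2 + w.2 ^ 2 = 1 := hw
    simp only [binaryForm]
    nlinarith
  obtain ⟨⟨a, b, c⟩, ⟨ha, hc, hb, hle⟩, hmax⟩ := (isCompact_dominatedForms F).exists_isMaxOn
    ⟨_, hμmem⟩ (f := fun p => p.1 * p.2.2 - p.2.1 ^ 2) (by fun_prop)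
  simp only at ha hc hb hle
  have hmax' : ∀ a' b' c' : ℝ, 0 ≤ a' → 0 ≤ c' →
      (∀ w ∈ euclideanCircle, binaryForm a' b' c' w ≤ F w) →
      a' * c' - b' ^ 2 ≤ a * c - b ^ 2 := by
    intro a' b' c' ha' hc' h
    by_contra! hlt
    have hmem : (a', b', c') ∈ dominatedForms F :=
      ⟨ha', hc', by simp only; linarith,
        le_of_le_on_euclideanCircle hhom (binaryForm_smul _ _ _) h⟩
    exact hlt.not_ge (hmax hmem)
  set D := a * c - b ^ 2 with hD
  have hDpos : 0 < D := by
    have : μ * μ - 0 ^ 2 ≤ D := hmax hμmem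
    nlinarith
  have hu : ∃ u ∈ euclideanCircle, binaryForm a b c u = F u := by
    by_contra! hne
    obtain ⟨δ, hδ, hδF⟩ := exists_pos_add_le_of_lt isCompact_euclideanCircle hcont
      (continuous_binaryForm a b c) fun w hw => lt_of_le_of_ne (hle w) (hne w hw)
    have := hmax' (a + δ) b (c + δ) (by linarith) (by linarith) fun w hw => by
      have h₁ := hδF w hw
      have h₂ : w.1 ^ 2 + w.2 ^ 2 = 1 := hw
      simp only [binaryForm] at h₁ ⊢
      linear_combination h₁ + δ * h₂
    nlinarith [mul_nonneg hδ.le ha, mul_nonneg hδ.le hc, mul_pos hδ hδ]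
  obtain ⟨u, huS, hu⟩ := hu
  have hFu := hpos u (ne_zero_of_mem_euclideanCircle huS)
  set M := 3 * D / F u with hM
  have hMpos : 0 < M := by positivity
  have hMu : M * F u = 3 * D := by rw [hM]; field_simp
  let T : Set (ℝ × ℝ) := euclideanCircle ∩
    {w | binaryForm a b c w ≤ M * (u.1 * w.2 - u.2 * w.1) ^ 2}
  have hT : IsCompact T := isCompact_euclideanCircle.inter_right
    (isClosed_le (continuous_binaryForm a b c) (by fun_prop))
  have hv : ∃ v ∈ T, binaryForm a b c v = F v := by
    by_contra! hne
    obtain ⟨m, hm, hmF⟩ := exists_pos_add_le_of_lt hT hcont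
      (continuous_binaryForm a b c) fun w hw => lt_of_le_of_ne (hle w) (hne w hw)
    obtain ⟨ε, hε, hε4, hεM⟩ : ∃ ε : ℝ, 0 < ε ∧ ε ≤ 1 / 4 ∧ ε * M ≤ m :=
      ⟨min (1 / 4) (m / M), by positivity, min_le_left _ _,
        (le_div_iff₀ hMpos).1 (min_le_right _ _)⟩
    have := hmax' ((1 - ε) * a + ε * M * u.2 ^ 2) ((1 - ε) * b - ε * M * (u.1 * u.2))
      ((1 - ε) * c + ε * M * u.1 ^ 2)
      (add_nonneg (mul_nonneg (by linarith) ha) (by positivity))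
      (add_nonneg (mul_nonneg (by linarith) hc) (by positivity)) fun w hw => by
        have hexp : binaryForm ((1 - ε) * a + ε * M * u.2 ^ 2)
            ((1 - ε) * b - ε * M * (u.1 * u.2)) ((1 - ε) * c + ε * M * u.1 ^ 2) w =
            (1 - ε) * binaryForm a b c w + ε * (M * (u.1 * w.2 - u.2 * w.1) ^ 2) := by
          simp only [binaryForm]
          ring
        rw [hexp]
        by_cases hwT : binaryForm a b c w ≤ M * (u.1 * w.2 - u.2 * w.1) ^ 2
        · have h₁ := hmF w ⟨hw, hwT⟩
          have h₂ := binaryForm_nonneg ha hc hb w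
          have h₃ : (u.1 * w.2 - u.2 * w.1) ^ 2 ≤ 1 := by
            have e₁ : w.1 ^ 2 + w.2 ^ 2 = 1 := hw
            have e₂ : u.1 ^ 2 + u.2 ^ 2 = 1 := huS
            have e₃ : (u.1 * w.2 - u.2 * w.1) ^ 2 + (u.1 * w.1 + u.2 * w.2) ^ 2 = 1 := by
              linear_combination (u.1 ^ 2 + u.2 ^ 2) * e₁ + e₂
            nlinarith [sq_nonneg (u.1 * w.1 + u.2 * w.2)]
          nlinarith [mul_le_mul_of_nonneg_left h₃ (mul_pos hε hMpos).le,
            mul_nonneg hε.le h₂]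
        · have h₁ := hle w
          nlinarith [mul_pos hε (sub_pos.2 (not_le.1 hwT))]
    have hdet : ((1 - ε) * a + ε * M * u.2 ^ 2) * ((1 - ε) * c + ε * M * u.1 ^ 2) -
        ((1 - ε) * b - ε * M * (u.1 * u.2)) ^ 2 = (1 - ε) * (1 + 2 * ε) * D := by
      simp only [binaryForm] at hu
      rw [← hu] at hMu
      linear_combination (1 - ε) * ε * hMu
    rw [hdet] at this
    nlinarith [mul_pos hε hDpos, mul_le_mul_of_nonneg_right hε4 (mul_pos hε hDpos).le]
  obtain ⟨v, ⟨hvS, hvT⟩, hv⟩ := hv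
  refine ⟨a, b, c, hle, u, v, fun h0 => ?_, hu, hv⟩
  have hFv := hpos v (ne_zero_of_mem_euclideanCircle hvS)
  rw [Set.mem_ofPred_eq, h0, hv] at hvT
  linarith

section SkewInequality

variable {X : Type*} [NormedAddCommGroup X] [NormedSpace ℝ X]

theorem norm_sq_add_norm_sq_le_of_norm_eq_one
    (h : ∀ τ υ : ℝ, 0 ≤ τ → 0 ≤ υ → ∀ x y : X, ‖x‖ = 1 → ‖y‖ = 1 →
      ‖τ • x + υ • y‖ ^ 2 + ‖υ • x - τ • y‖ ^ 2 ≤ 2 * (τ ^ 2 + υ ^ 2))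
    (τ υ : ℝ) {x y : X} (hx : ‖x‖ = 1) (hy : ‖y‖ = 1) :
    ‖τ • x + υ • y‖ ^ 2 + ‖υ • x - τ • y‖ ^ 2 ≤ 2 * (τ ^ 2 + υ ^ 2) := by
  wlog hτ : 0 ≤ τ generalizing τ υ
  · have := this (-τ) (-υ) (by linarith)
    rwa [neg_smul, neg_smul, ← neg_add, norm_neg, neg_smul, neg_smul, ← neg_sub', norm_neg,
      neg_sq, neg_sq] at this
  rcases le_total 0 υ with hυ | hυ
  · exact h τ υ hτ hυ x y hx hy
  · have := h τ (-υ) hτ (by linarith) x (-y) hx (by rwa [norm_neg])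
    have e : (-υ) • x - τ • (-y) = -(υ • x - τ • y) := by module
    rw [neg_smul_neg, e, norm_neg, neg_sq] at this
    exact this

/-- The skew inequality for unit vectors, rescaled to arbitrary nonzero vectors. -/
theorem norm_sq_add_norm_sq_le_of_ne_zero
    (h : ∀ τ υ : ℝ, 0 ≤ τ → 0 ≤ υ → ∀ x y : X, ‖x‖ = 1 → ‖y‖ = 1 →
      ‖τ • x + υ • y‖ ^ 2 + ‖υ • x - τ • y‖ ^ 2 ≤ 2 * (τ ^ 2 + υ ^ 2))
    (τ υ : ℝ) {x y : X} (hx : x ≠ 0) (hy : y ≠ 0) :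
    ‖τ • x + υ • y‖ ^ 2 + ‖(υ * ‖y‖ / ‖x‖) • x - (τ * ‖x‖ / ‖y‖) • y‖ ^ 2 ≤
      2 * ((τ * ‖x‖) ^ 2 + (υ * ‖y‖) ^ 2) := by
  have hx' := norm_ne_zero_iff.2 hx
  have hy' := norm_ne_zero_iff.2 hy
  have := norm_sq_add_norm_sq_le_of_norm_eq_one h (τ * ‖x‖) (υ * ‖y‖)
    (norm_smul_inv_norm (𝕜 := ℝ) hx) (norm_smul_inv_norm (𝕜 := ℝ) hy)
  simp only [RCLike.ofReal_real_eq_id, id_eq, smul_smul] at this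
  rwa [mul_inv_cancel_right₀ hx', mul_inv_cancel_right₀ hy', ← div_eq_mul_inv,
    ← div_eq_mul_inv] at this

theorem parallelogram_smul (r : ℝ) (x : X) :
    ‖x + r • x‖ ^ 2 + ‖x - r • x‖ ^ 2 = 2 * ‖x‖ ^ 2 + 2 * ‖r • x‖ ^ 2 := by
  have h₁ : x + r • x = (1 + r) • x := by module
  have h₂ : x - r • x = (1 - r) • x := by module
  rw [h₁, h₂, norm_smul, norm_smul, norm_smul]
  simp only [mul_pow, Real.norm_eq_abs, sq_abs]
  ring

theorem parallelogram_of_linearIndependent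
    (h : ∀ τ υ : ℝ, 0 ≤ τ → 0 ≤ υ → ∀ x y : X, ‖x‖ = 1 → ‖y‖ = 1 →
      ‖τ • x + υ • y‖ ^ 2 + ‖υ • x - τ • y‖ ^ 2 ≤ 2 * (τ ^ 2 + υ ^ 2))
    {x y : X} (hxy : LinearIndependent ℝ ![x, y]) :
    ‖x + y‖ ^ 2 + ‖x - y‖ ^ 2 = 2 * ‖x‖ ^ 2 + 2 * ‖y‖ ^ 2 := by
  let P : ℝ × ℝ → X := fun w => w.1 • x + w.2 • y
  have hPne : ∀ w, w ≠ 0 → P w ≠ 0 := fun w hw h0 =>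
    hw (Prod.ext_iff.2 (LinearIndependent.pair_iff.1 hxy _ _ h0))
  have hPlin : ∀ (r s : ℝ) (u v : ℝ × ℝ), P (r • u + s • v) = r • P u + s • P v := by
    intro r s u v
    simp only [P, Prod.fst_add, Prod.snd_add, Prod.smul_fst, Prod.smul_snd, smul_eq_mul]
    module
  obtain ⟨a, b, c, hle, u, v, hdet, hu, hv⟩ :=
    exists_binaryForm_le_and_contact (F := fun w => ‖P w‖ ^ 2) (by fun_prop)
      (fun r w => by
        have := hPlin r 0 w 0
        rw [zero_smul, zero_smul, add_zero, add_zero] at this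
        simp only [this, norm_smul, mul_pow, Real.norm_eq_abs, sq_abs])
      (fun w hw => by have := norm_pos_iff.2 (hPne w hw); positivity)
  have hu0 : P u ≠ 0 := hPne u (by rintro rfl; simp at hdet)
  have hv0 : P v ≠ 0 := hPne v (by rintro rfl; simp at hdet)
  have heq : ∀ w, ‖P w‖ ^ 2 = binaryForm a b c w := by
    intro w
    refine le_antisymm ?_ (hle w)
    obtain ⟨α, β, rfl⟩ : ∃ α β : ℝ, w = α • u + β • v := by
      refine ⟨(w.1 * v.2 - w.2 * v.1) / (u.1 * v.2 - u.2 * v.1),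
        (u.1 * w.2 - u.2 * w.1) / (u.1 * v.2 - u.2 * v.1), Prod.ext ?_ ?_⟩ <;>
      · simp only [Prod.fst_add, Prod.snd_add, Prod.smul_fst, Prod.smul_snd, smul_eq_mul]
        rw [div_mul_eq_mul_div, div_mul_eq_mul_div, ← add_div, eq_div_iff hdet]
        ring
    have h₁ := norm_sq_add_norm_sq_le_of_ne_zero h α β hu0 hv0
    have h₂ := hle ((β * ‖P v‖ / ‖P u‖) • u + (-(α * ‖P u‖ / ‖P v‖)) • v)
    rw [sub_eq_add_neg, ← neg_smul] at h₁
    have key : ∀ r s : ℝ, binaryForm a b c (r • u + s • v) = r ^ 2 * ‖P u‖ ^ 2 +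
        s ^ 2 * ‖P v‖ ^ 2 + 2 * (r * s) *
          (a * u.1 * v.1 + b * (u.1 * v.2 + u.2 * v.1) + c * u.2 * v.2) := by
      intro r s
      rw [← hu, ← hv]
      simp only [binaryForm, Prod.fst_add, Prod.snd_add, Prod.smul_fst, Prod.smul_snd,
        smul_eq_mul]
      ring
    rw [hPlin, key] at h₂ ⊢
    have hnu := norm_ne_zero_iff.2 hu0
    have hnv := norm_ne_zero_iff.2 hv0
    have e₁ : (β * ‖P v‖ / ‖P u‖) ^ 2 * ‖P u‖ ^ 2 = β ^ 2 * ‖P v‖ ^ 2 := by field_simp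
    have e₂ : (-(α * ‖P u‖ / ‖P v‖)) ^ 2 * ‖P v‖ ^ 2 = α ^ 2 * ‖P u‖ ^ 2 := by field_simp
    have e₃ : β * ‖P v‖ / ‖P u‖ * -(α * ‖P u‖ / ‖P v‖) = -(α * β) := by field_simp
    rw [e₁, e₂, e₃] at h₂
    linarith
  have h₁ := heq (1, 1)
  have h₂ := heq (1, -1)
  have h₃ := heq (1, 0)
  have h₄ := heq (0, 1)
  simp only [P, binaryForm, one_smul, neg_smul, zero_smul, add_zero, zero_add,
    ← sub_eq_add_neg] at h₁ h₂ h₃ h₄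
  rw [h₁, h₂, h₃, h₄]
  ring

end SkewInequality

/-- A nontrivial real normed linear space `X` is an inner product
space (norm satisfies the parallelogram law) iff
`‖τx + υy‖² + ‖υx − τy‖² ≤ 2(τ² + υ²)` for all `τ, υ ≥ 0` and all `x, y ∈ S_X`. -/
theorem stmt11 (X : Type*) [NormedAddCommGroup X] [NormedSpace ℝ X] [Nontrivial X] :
    (∀ x y : X, ‖x + y‖ ^ 2 + ‖x - y‖ ^ 2 = 2 * ‖x‖ ^ 2 + 2 * ‖y‖ ^ 2) ↔
      ∀ τ υ : ℝ, 0 ≤ τ → 0 ≤ υ → ∀ x y : X, ‖x‖ = 1 → ‖y‖ = 1 →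
        ‖τ • x + υ • y‖ ^ 2 + ‖υ • x - τ • y‖ ^ 2 ≤ 2 * (τ ^ 2 + υ ^ 2) := by
  constructor
  · intro hpar τ υ _ _ x y hx hy
    let := InnerProductSpace.ofNorm (𝕜 := ℝ) (E := X) fun x y => by linarith [hpar x y]
    rw [norm_add_sq_real, norm_sub_sq_real]
    simp only [inner_smul_left, inner_smul_right, norm_smul, hx, hy, mul_pow, Real.norm_eq_abs,
      sq_abs, RCLike.conj_to_real]
    linarith
  · intro h x y
    by_cases hxy : LinearIndependent ℝ ![x, y]
    · exact parallelogram_of_linearIndependent h hxy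
    · rcases eq_or_ne x 0 with rfl | hx
      · simp [two_mul]
      · rw [LinearIndependent.pair_iff' hx] at hxy
        push Not at hxy
        obtain ⟨r, rfl⟩ := hxy
        exact parallelogram_smul r x
end
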